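/- arXiv:2204.07378 — 2 statements merged into one kernel-verified Lean document; each statement's English description precedes it below -/
import Mathlib

section
/- For each unitary cost c ≥ 0 there exist subsets m and M of {1,…,n}, both optimal at c, such that every subset optimal at c contains m and is contained in M; in particular the minimal optimal set and the maximal optimal set at c are unique. -/
open Finset

/-- Expected revenue of a set of customers. -/
def R (pi p : ℕ → ℝ) (S : Finset ℕ) : ℝ := ∑ i ∈ S, pi i * p i

/-- Expected traveled distance (with l i = 2 * x i). -/
def L (x pi : ℕ → ℝ) (S : Finset ℕ) : ℝ :=
  ∑ i ∈ S, (2 * x i) * pi i * ∏ j ∈ S.filter (fun j => i < j), (1 - pi j)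

/-- Expected profit at unitary cost c. -/
def G (x pi p : ℕ → ℝ) (S : Finset ℕ) (c : ℝ) : ℝ := R pi p S - c * L x pi S

/-- Optimal value of the probabilistic profitable tour problem on a line. -/
def PPTP (n : ℕ) (x pi p : ℕ → ℝ) (c : ℝ) : ℝ :=
  (Finset.Icc 1 n).powerset.sup' (Finset.powerset_nonempty _) (fun S => G x pi p S c)

/-- Adding a customer farther than all those of `S`. -/
theorem L_insert_of_forall_lt (x pi : ℕ → ℝ) {S : Finset ℕ} {a : ℕ} (h : ∀ i ∈ S, i < a) :
    L x pi (insert a S) = (1 - pi a) * L x pi S + 2 * x a * pi a := by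
  have ha : a ∉ S := fun h' => lt_irrefl _ (h a h')
  have h_top : (insert a S).filter (fun j => a < j) = ∅ := by
    ext j
    simp only [mem_filter, mem_insert, notMem_empty, iff_false]
    rintro ⟨rfl | hj, hlt⟩
    · exact lt_irrefl _ hlt
    · exact lt_asymm hlt (h j hj)
  unfold L
  rw [sum_insert ha, h_top, prod_empty, mul_sum, mul_one, add_comm]
  congr 1
  refine sum_congr rfl fun i hi => ?_
  rw [filter_insert, if_pos (h i hi), prod_insert (by simp [ha])]
  ring

theorem L_inter_Icc_succ (x pi : ℕ → ℝ) (S : Finset ℕ) (k : ℕ) :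
    L x pi (S ∩ Icc 1 (k + 1)) =
      if k + 1 ∈ S then (1 - pi (k + 1)) * L x pi (S ∩ Icc 1 k) + 2 * x (k + 1) * pi (k + 1)
      else L x pi (S ∩ Icc 1 k) := by
  split_ifs with h
  · rw [← L_insert_of_forall_lt x pi (S := S ∩ Icc 1 k) (a := k + 1)
      (by intro i hi; simp only [mem_inter, mem_Icc] at hi; omega)]
    congr 1
    ext i
    simp only [mem_inter, mem_Icc, mem_insert]
    grind
  · congr 1
    ext i
    simp only [mem_inter, mem_Icc]
    grind

theorem L_inter_zero (x pi : ℕ → ℝ) (S : Finset ℕ) : L x pi (S ∩ Icc 1 0) = 0 := by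
  simp [L]

section

variable {n : ℕ} {x pi : ℕ → ℝ}

theorem L_inter_Icc_le (hx : ∀ i ∈ Icc 1 n, 0 < x i)
    (hxmono : ∀ i, 1 ≤ i → i + 1 ≤ n → x i ≤ x (i + 1))
    (hpi : ∀ i ∈ Icc 1 n, 0 < pi i ∧ pi i ≤ 1) (S : Finset ℕ) :
    ∀ k, k + 1 ≤ n → L x pi (S ∩ Icc 1 k) ≤ 2 * x (k + 1) := by
  intro k
  induction k with
  | zero =>
    intro hk
    rw [L_inter_zero]
    linarith [hx 1 (mem_Icc.2 ⟨le_rfl, hk⟩)]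
  | succ k ih =>
    intro hk
    have h_le := ih (by omega)
    have h_mono := hxmono (k + 1) (by omega) hk
    obtain ⟨-, h1⟩ := hpi (k + 1) (mem_Icc.2 ⟨by omega, by omega⟩)
    rw [L_inter_Icc_succ]
    split_ifs
    · nlinarith [mul_le_mul_of_nonneg_left h_le (sub_nonneg.2 h1)]
    · linarith

theorem L_inter_Icc_mono (hx : ∀ i ∈ Icc 1 n, 0 < x i)
    (hxmono : ∀ i, 1 ≤ i → i + 1 ≤ n → x i ≤ x (i + 1))
    (hpi : ∀ i ∈ Icc 1 n, 0 < pi i ∧ pi i ≤ 1) {S T : Finset ℕ} (hST : S ⊆ T) :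
    ∀ k, k ≤ n → L x pi (S ∩ Icc 1 k) ≤ L x pi (T ∩ Icc 1 k) := by
  intro k
  induction k with
  | zero => intro _; simp only [L_inter_zero, le_refl]
  | succ k ih =>
    intro hk
    have h_le := ih (by omega)
    have h_bound := L_inter_Icc_le hx hxmono hpi S k hk
    obtain ⟨h0, h1⟩ := hpi (k + 1) (mem_Icc.2 ⟨by omega, by omega⟩)
    have h_mul := mul_le_mul_of_nonneg_left h_le (sub_nonneg.2 h1)
    rw [L_inter_Icc_succ, L_inter_Icc_succ]
    split_ifs with hS hT hT
    · linarith
    · exact absurd (hST hS) hT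
    · nlinarith [mul_le_mul_of_nonneg_left h_bound h0.le]
    · exact h_le

theorem L_inter_Icc_submodular (hx : ∀ i ∈ Icc 1 n, 0 < x i)
    (hxmono : ∀ i, 1 ≤ i → i + 1 ≤ n → x i ≤ x (i + 1))
    (hpi : ∀ i ∈ Icc 1 n, 0 < pi i ∧ pi i ≤ 1) (S T : Finset ℕ) :
    ∀ k, k ≤ n → L x pi ((S ∪ T) ∩ Icc 1 k) + L x pi ((S ∩ T) ∩ Icc 1 k) ≤
      L x pi (S ∩ Icc 1 k) + L x pi (T ∩ Icc 1 k) := by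
  intro k
  induction k with
  | zero => intro _; simp only [L_inter_zero, le_refl]
  | succ k ih =>
    intro hk
    have h_le := ih (by omega)
    have hS_mono := L_inter_Icc_mono hx hxmono hpi (inter_subset_left (s₁ := S) (s₂ := T)) k
      (by omega)
    have hT_mono := L_inter_Icc_mono hx hxmono hpi (inter_subset_right (s₁ := S) (s₂ := T)) k
      (by omega)
    obtain ⟨h0, h1⟩ := hpi (k + 1) (mem_Icc.2 ⟨by omega, by omega⟩)
    have h_mul := mul_le_mul_of_nonneg_left h_le (sub_nonneg.2 h1)
    have hS_mul := mul_le_mul_of_nonneg_left hS_mono h0.le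
    have hT_mul := mul_le_mul_of_nonneg_left hT_mono h0.le
    simp only [L_inter_Icc_succ]
    by_cases hS : k + 1 ∈ S <;> by_cases hT : k + 1 ∈ T <;>
      simp only [mem_union, mem_inter, hS, hT, or_self, or_true, or_false, and_self,
        and_true, and_false, if_true, if_false] <;> linarith

theorem G_supermodular (hx : ∀ i ∈ Icc 1 n, 0 < x i)
    (hxmono : ∀ i, 1 ≤ i → i + 1 ≤ n → x i ≤ x (i + 1))
    (hpi : ∀ i ∈ Icc 1 n, 0 < pi i ∧ pi i ≤ 1) (p : ℕ → ℝ) {c : ℝ} (hc : 0 ≤ c)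
    {S T : Finset ℕ} (hS : S ⊆ Icc 1 n) (hT : T ⊆ Icc 1 n) :
    G x pi p S c + G x pi p T c ≤ G x pi p (S ∪ T) c + G x pi p (S ∩ T) c := by
  have hL := L_inter_Icc_submodular hx hxmono hpi S T n le_rfl
  rw [inter_eq_left.2 hS, inter_eq_left.2 hT, inter_eq_left.2 (union_subset hS hT),
    inter_eq_left.2 (inter_subset_left.trans hS)] at hL
  have hR : R pi p (S ∪ T) + R pi p (S ∩ T) = R pi p S + R pi p T := sum_union_inter
  unfold G
  linarith [mul_le_mul_of_nonneg_left hL hc]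

end

theorem G_le_PPTP {n : ℕ} (x pi p : ℕ → ℝ) (c : ℝ) {S : Finset ℕ} (hS : S ⊆ Icc 1 n) :
    G x pi p S c ≤ PPTP n x pi p c :=
  le_sup' (fun S => G x pi p S c) (mem_powerset.2 hS)

theorem stmt9 (n : ℕ) (x p pi : ℕ → ℝ)
    (hx : ∀ i ∈ Finset.Icc 1 n, 0 < x i)
    (hxmono : ∀ i, 1 ≤ i → i + 1 ≤ n → x i ≤ x (i + 1))
    (hp : ∀ i ∈ Finset.Icc 1 n, 0 < p i)
    (hpi : ∀ i ∈ Finset.Icc 1 n, 0 < pi i ∧ pi i ≤ 1)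
    (c : ℝ) (hc : 0 ≤ c) :
    ∃ m M : Finset ℕ, m ⊆ Finset.Icc 1 n ∧ M ⊆ Finset.Icc 1 n ∧
      G x pi p m c = PPTP n x pi p c ∧ G x pi p M c = PPTP n x pi p c ∧
      ∀ S : Finset ℕ, S ⊆ Finset.Icc 1 n → G x pi p S c = PPTP n x pi p c →
        m ⊆ S ∧ S ⊆ M := by
  set O : Finset (Finset ℕ) :=
    (Icc 1 n).powerset.filter (fun S => G x pi p S c = PPTP n x pi p c) with hO
  have mem_O : ∀ S, S ∈ O ↔ S ⊆ Icc 1 n ∧ G x pi p S c = PPTP n x pi p c := by simp [hO]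
  have O_nonempty : O.Nonempty := by
    obtain ⟨S, hS, h_eq⟩ := exists_mem_eq_sup' (powerset_nonempty (Icc 1 n))
      (fun S => G x pi p S c)
    exact ⟨S, (mem_O S).2 ⟨mem_powerset.1 hS, h_eq.symm⟩⟩
  have O_lattice : ∀ S ∈ O, ∀ T ∈ O, S ∪ T ∈ O ∧ S ∩ T ∈ O := by
    intro S hS T hT
    obtain ⟨hS, hS_eq⟩ := (mem_O S).1 hS
    obtain ⟨hT, hT_eq⟩ := (mem_O T).1 hT
    have h_union := union_subset hS hT
    have h_inter : S ∩ T ⊆ Icc 1 n := inter_subset_left.trans hS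
    have h_super := G_supermodular hx hxmono hpi p hc hS hT
    have hU_le := G_le_PPTP x pi p c h_union
    have hI_le := G_le_PPTP x pi p c h_inter
    exact ⟨(mem_O _).2 ⟨h_union, by linarith⟩, (mem_O _).2 ⟨h_inter, by linarith⟩⟩
  have hm : O.inf' O_nonempty id ∈ O :=
    inf'_mem (O : Set (Finset ℕ)) (fun S hS T hT => (O_lattice S hS T hT).2) _ _ _
      fun _ h => h
  have hM : O.sup' O_nonempty id ∈ O :=
    sup'_mem (O : Set (Finset ℕ)) (fun S hS T hT => (O_lattice S hS T hT).1) _ _ _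
      fun _ h => h
  obtain ⟨hm, hm_eq⟩ := (mem_O _).1 hm
  obtain ⟨hM, hM_eq⟩ := (mem_O _).1 hM
  refine ⟨_, _, hm, hM, hm_eq, hM_eq, fun S hS hS_eq => ?_⟩
  have hSO := (mem_O S).2 ⟨hS, hS_eq⟩
  exact ⟨inf'_le id hSO, le_sup' id hSO⟩
end

section
/- The set of unitary costs c ≥ 0 at which there exist two distinct optimal sets (the corner points of the function c ↦ PPTP(c)) is finite and has cardinality at most n. -/
open Finset

lemma L_insert_of_lt (x pi : ℕ → ℝ) {a : ℕ} {S : Finset ℕ} (ha : ∀ i ∈ S, i < a) :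
    L x pi (insert a S) = 2 * x a * pi a + (1 - pi a) * L x pi S := by
  have haS : a ∉ S := fun h => lt_irrefl a (ha a h)
  unfold L
  rw [sum_insert haS, mul_sum]
  congr 1
  · have hempty : (insert a S).filter (fun j => a < j) = ∅ := by
      ext j
      simp only [mem_filter, mem_insert, notMem_empty, iff_false, not_and, not_lt]
      rintro (rfl | hj)
      · exact le_rfl
      · exact (ha j hj).le
    rw [hempty, prod_empty, mul_one]
  · refine sum_congr rfl fun i hi => ?_
    rw [filter_insert, if_pos (ha i hi), prod_insert (by simp [haS])]
    ring

/-- A subset of `insert a U` either avoids `a` or is obtained by adding `a` to a subset of `U`. -/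
lemma subset_or_eq_insert_of_subset_insert {a : ℕ} {S U : Finset ℕ} (h : S ⊆ insert a U) :
    S ⊆ U ∨ ∃ S' ⊆ U, S = insert a S' := by
  by_cases ha : a ∈ S
  · exact Or.inr ⟨S.erase a, subset_insert_iff.1 h, (insert_erase ha).symm⟩
  · exact Or.inl ((subset_insert_iff_of_notMem ha).1 h)

section Distance

variable {x pi : ℕ → ℝ}

lemma L_le_of_forall_le {S : Finset ℕ} {y : ℝ} (hy : 0 ≤ y) (hxy : ∀ i ∈ S, x i ≤ y)
    (hpi : ∀ i ∈ S, 0 ≤ pi i ∧ pi i ≤ 1) : L x pi S ≤ 2 * y := by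
  induction S using Finset.induction_on_max with
  | empty => simpa [L] using hy
  | insert a S ha ih =>
    simp only [mem_insert, forall_eq_or_imp] at hxy hpi
    have hS := ih hxy.2 hpi.2
    rw [L_insert_of_lt x pi ha]
    nlinarith [mul_le_mul_of_nonneg_left hS (sub_nonneg.2 hpi.1.2),
      mul_le_mul_of_nonneg_right hxy.1 hpi.1.1]

lemma L_mono {S T U : Finset ℕ} (hx : ∀ i ∈ U, 0 ≤ x i) (hmono : MonotoneOn x U)
    (hpi : ∀ i ∈ U, 0 ≤ pi i ∧ pi i ≤ 1) (hT : T ⊆ U) (hST : S ⊆ T) :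
    L x pi S ≤ L x pi T := by
  induction U using Finset.induction_on_max generalizing S T with
  | empty =>
    rw [subset_empty.1 hT] at hST ⊢
    rw [subset_empty.1 hST]
  | insert a U ha ih =>
    have hpia := hpi a (mem_insert_self a U)
    have hle : ∀ i ∈ U, x i ≤ x a := fun i hi =>
      hmono (by simp [hi]) (by simp) (ha i hi).le
    have hxa := hx a (mem_insert_self a U)
    have hpiU : ∀ i ∈ U, 0 ≤ pi i ∧ pi i ≤ 1 := fun i hi => hpi i (mem_insert_of_mem hi)
    have ih' : ∀ {S T : Finset ℕ}, T ⊆ U → S ⊆ T → L x pi S ≤ L x pi T :=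
      ih (fun i hi => hx i (mem_insert_of_mem hi)) (hmono.mono (by simp)) hpiU
    rcases subset_or_eq_insert_of_subset_insert hT with hT' | ⟨T', hT', rfl⟩
    · exact ih' hT' hST
    · rw [L_insert_of_lt x pi fun i hi => ha i (hT' hi)]
      rcases subset_or_eq_insert_of_subset_insert hST with hS' | ⟨S', hS', rfl⟩
      · have hST' := ih' hT' hS'
        have hbound : L x pi S ≤ 2 * x a :=
          L_le_of_forall_le hxa (fun i hi => hle i (hT' (hS' hi)))
            fun i hi => hpiU i (hT' (hS' hi))
        nlinarith [mul_le_mul_of_nonneg_left hST' (sub_nonneg.2 hpia.2),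
          mul_le_mul_of_nonneg_left hbound hpia.1]
      · rw [L_insert_of_lt x pi fun i hi => ha i (hT' (hS' hi))]
        have := mul_le_mul_of_nonneg_left (ih' hT' hS') (sub_nonneg.2 hpia.2)
        linarith

lemma L_union_add_L_inter_le {S T U : Finset ℕ} (hx : ∀ i ∈ U, 0 ≤ x i)
    (hmono : MonotoneOn x U) (hpi : ∀ i ∈ U, 0 ≤ pi i ∧ pi i ≤ 1) (hS : S ⊆ U) (hT : T ⊆ U) :
    L x pi (S ∪ T) + L x pi (S ∩ T) ≤ L x pi S + L x pi T := by
  induction U using Finset.induction_on_max generalizing S T with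
  | empty =>
    rw [subset_empty.1 hS, subset_empty.1 hT]
    simp
  | insert a U ha ih =>
    have haU : a ∉ U := fun h => lt_irrefl a (ha a h)
    have hpia := hpi a (mem_insert_self a U)
    have hxU : ∀ i ∈ U, 0 ≤ x i := fun i hi => hx i (mem_insert_of_mem hi)
    have hmonoU : MonotoneOn x U := hmono.mono (by simp)
    have hpiU : ∀ i ∈ U, 0 ≤ pi i ∧ pi i ≤ 1 := fun i hi => hpi i (mem_insert_of_mem hi)
    have ih' : ∀ {S T : Finset ℕ}, S ⊆ U → T ⊆ U →
        L x pi (S ∪ T) + L x pi (S ∩ T) ≤ L x pi S + L x pi T := ih hxU hmonoU hpiU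
    have hrec : ∀ {S : Finset ℕ}, S ⊆ U →
        L x pi (insert a S) = 2 * x a * pi a + (1 - pi a) * L x pi S :=
      fun h => L_insert_of_lt x pi fun i hi => ha i (h hi)
    have hmixed : ∀ {S T : Finset ℕ}, S ⊆ U → T ⊆ U →
        L x pi (insert a S ∪ T) + L x pi (insert a S ∩ T) ≤
          L x pi (insert a S) + L x pi T := by
      intro S T hS hT
      rw [insert_union, insert_inter_of_notMem fun h => haU (hT h), hrec hS,
        hrec (union_subset hS hT)]
      have hle : L x pi S ≤ L x pi (S ∪ T) :=
        L_mono hxU hmonoU hpiU (union_subset hS hT) subset_union_left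
      nlinarith [ih' hS hT, mul_le_mul_of_nonneg_left hle hpia.1]
    rcases subset_or_eq_insert_of_subset_insert hS with hS' | ⟨S', hS', rfl⟩ <;>
      rcases subset_or_eq_insert_of_subset_insert hT with hT' | ⟨T', hT', rfl⟩
    · exact ih' hS' hT'
    · rw [union_comm, inter_comm, add_comm (L x pi S)]
      exact hmixed hT' hS'
    · exact hmixed hS' hT'
    · rw [← insert_union_distrib, ← insert_inter_distrib, hrec hS', hrec hT',
        hrec (union_subset hS' hT'), hrec (inter_subset_left.trans hS')]
      nlinarith [mul_le_mul_of_nonneg_left (ih' hS' hT') (sub_nonneg.2 hpia.2)]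

end Distance

lemma R_union_add_R_inter (pi p : ℕ → ℝ) (S T : Finset ℕ) :
    R pi p (S ∪ T) + R pi p (S ∩ T) = R pi p S + R pi p T :=
  sum_union_inter

lemma R_lt_of_ssubset {pi p : ℕ → ℝ} {S T : Finset ℕ} (hST : S ⊂ T)
    (hpos : ∀ i ∈ T, 0 < pi i * p i) : R pi p S < R pi p T := by
  obtain ⟨i, hiT, hiS⟩ := exists_of_ssubset hST
  exact sum_lt_sum_of_subset hST.subset hiT hiS (hpos i hiT) fun j hj _ => (hpos j hj).le

/-- Optimal sets shrink as the unitary cost increases. -/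
lemma subset_of_optimal_of_lt {x pi p : ℕ → ℝ} {S T U : Finset ℕ} {c d : ℝ}
    (hx : ∀ i ∈ U, 0 ≤ x i) (hmono : MonotoneOn x U) (hpi : ∀ i ∈ U, 0 ≤ pi i ∧ pi i ≤ 1)
    (hpos : ∀ i ∈ U, 0 < pi i * p i) (hc : 0 ≤ c) (hcd : c < d) (hS : S ⊆ U) (hT : T ⊆ U)
    (hSopt : ∀ V ⊆ U, G x pi p V c ≤ G x pi p S c)
    (hTopt : ∀ V ⊆ U, G x pi p V d ≤ G x pi p T d) : T ⊆ S := by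
  by_contra hTS
  have hss : S ∩ T ⊂ T :=
    (inter_subset_right).ssubset_of_ne fun h => hTS (inter_eq_right.1 h)
  have hR := R_lt_of_ssubset hss fun i hi => hpos i (hT hi)
  have hRsum := R_union_add_R_inter pi p S T
  have hL : L x pi (S ∩ T) ≤ L x pi T := L_mono hx hmono hpi hT inter_subset_right
  have hLsum := mul_le_mul_of_nonneg_left (L_union_add_L_inter_le hx hmono hpi hS hT) hc
  have hunion := hSopt (S ∪ T) (union_subset hS hT)
  have hinter := hTopt (S ∩ T) (inter_subset_left.trans hS)
  unfold G at hunion hinter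
  rcases hL.eq_or_lt with hLeq | hLlt
  · rw [hLeq] at hLsum
    nlinarith
  · nlinarith [mul_pos (sub_pos.2 hcd) (sub_pos.2 hLlt)]

theorem stmt18 (n : ℕ) (x p pi : ℕ → ℝ)
    (hx : ∀ i ∈ Finset.Icc 1 n, 0 < x i)
    (hxmono : ∀ i, 1 ≤ i → i + 1 ≤ n → x i ≤ x (i + 1))
    (hp : ∀ i ∈ Finset.Icc 1 n, 0 < p i)
    (hpi : ∀ i ∈ Finset.Icc 1 n, 0 < pi i ∧ pi i ≤ 1) :
    {c : ℝ | 0 ≤ c ∧ ∃ S₁ S₂ : Finset ℕ,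
        S₁ ⊆ Finset.Icc 1 n ∧ S₂ ⊆ Finset.Icc 1 n ∧ S₁ ≠ S₂ ∧
        G x pi p S₁ c = PPTP n x pi p c ∧ G x pi p S₂ c = PPTP n x pi p c}.Finite ∧
    {c : ℝ | 0 ≤ c ∧ ∃ S₁ S₂ : Finset ℕ,
        S₁ ⊆ Finset.Icc 1 n ∧ S₂ ⊆ Finset.Icc 1 n ∧ S₁ ≠ S₂ ∧
        G x pi p S₁ c = PPTP n x pi p c ∧ G x pi p S₂ c = PPTP n x pi p c}.ncard ≤ n := by
  set C := {c : ℝ | 0 ≤ c ∧ ∃ S₁ S₂ : Finset ℕ,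
        S₁ ⊆ Finset.Icc 1 n ∧ S₂ ⊆ Finset.Icc 1 n ∧ S₁ ≠ S₂ ∧
        G x pi p S₁ c = PPTP n x pi p c ∧ G x pi p S₂ c = PPTP n x pi p c}
  have hmono : MonotoneOn x (Icc 1 n : Finset ℕ) := by
    intro i hi j hj hij
    simp only [coe_Icc, Set.mem_Icc] at hi hj
    induction j, hij using Nat.le_induction with
    | base => exact le_rfl
    | succ k hik ih =>
      exact (ih ⟨by lia, by lia⟩).trans (hxmono k (by lia) hj.2)
  have hmax : ∀ {S : Finset ℕ} {c : ℝ}, G x pi p S c = PPTP n x pi p c →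
      ∀ V ⊆ Icc 1 n, G x pi p V c ≤ G x pi p S c := by
    intro S c h V hV
    rw [h]
    exact le_sup' (fun S => G x pi p S c) (mem_powerset.2 hV)
  have hnested : ∀ {c d : ℝ} {S T : Finset ℕ}, 0 ≤ c → c < d → S ⊆ Icc 1 n → T ⊆ Icc 1 n →
      G x pi p S c = PPTP n x pi p c → G x pi p T d = PPTP n x pi p d → T ⊆ S :=
    fun hc hcd hS hT hSopt hTopt =>
      subset_of_optimal_of_lt (fun i hi => (hx i hi).le) hmono
        (fun i hi => ⟨(hpi i hi).1.le, (hpi i hi).2⟩)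
        (fun i hi => mul_pos (hpi i hi).1 (hp i hi)) hc hcd hS hT (hmax hSopt) (hmax hTopt)
  have hchoice : ∀ c : ℝ, ∃ S₁ S₂ : Finset ℕ, c ∈ C →
      S₁ ⊆ Icc 1 n ∧ S₂ ⊆ Icc 1 n ∧ S₁ ≠ S₂ ∧
        G x pi p S₁ c = PPTP n x pi p c ∧ G x pi p S₂ c = PPTP n x pi p c := by
    intro c
    by_cases hc : c ∈ C
    · obtain ⟨-, S₁, S₂, h⟩ := hc
      exact ⟨S₁, S₂, fun _ => h⟩
    · exact ⟨∅, ∅, fun h => absurd h hc⟩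
  choose S₁ S₂ hS using hchoice
  have hcard : ∀ c ∈ C, #(S₁ c ∩ S₂ c) < #(S₁ c ∪ S₂ c) := fun c hc =>
    card_lt_card (inf_lt_sup.2 (hS c hc).2.2.1)
  have hmaps : ∀ c ∈ C, #(S₁ c ∪ S₂ c) ∈ (Icc 1 n : Finset ℕ) := by
    intro c hc
    have hle := card_le_card (union_subset (hS c hc).1 (hS c hc).2.1)
    rw [Nat.card_Icc] at hle
    have := hcard c hc
    exact mem_Icc.2 ⟨by lia, by lia⟩
  have hanti : StrictAntiOn (fun c => #(S₁ c ∪ S₂ c)) C := by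
    intro c hc d hd hcd
    obtain ⟨h1, h2, -, h3, h4⟩ := hS c hc
    obtain ⟨k1, k2, -, k3, k4⟩ := hS d hd
    have hsub : S₁ d ∪ S₂ d ⊆ S₁ c ∩ S₂ c :=
      union_subset
        (subset_inter (hnested hc.1 hcd h1 k1 h3 k3) (hnested hc.1 hcd h2 k1 h4 k3))
        (subset_inter (hnested hc.1 hcd h1 k2 h3 k4) (hnested hc.1 hcd h2 k2 h4 k4))
    exact (card_le_card hsub).trans_lt (hcard c hc)
  have hfin : C.Finite :=
    Set.Finite.of_injOn hmaps hanti.injOn (Icc 1 n : Finset ℕ).finite_toSet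
  refine ⟨hfin, ?_⟩
  have hle := Set.ncard_le_ncard_of_injOn _ hmaps hanti.injOn (Icc 1 n : Finset ℕ).finite_toSet
  rwa [Set.ncard_coe_finset, Nat.card_Icc, Nat.add_sub_cancel] at hle
end
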